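/- arXiv:2510.06784 — 6 statements merged into one kernel-verified Lean document; each statement's English description precedes it below -/
import Mathlib

section
/- Let F be a field whose characteristic is zero or strictly greater than n, let z : Fin n → F and t : Fin d → F. Suppose there exist field elements μ'_0, …, μ'_{d−1} ∈ F such that in the field of rational functions F(X) the identity ∑_{j ∈ Fin n} (X + z_j)⁻¹ = ∑_{i ∈ Fin d} μ'_i · (X + t_i)⁻¹ holds. Then every value z j lies in the range of t. -/
/-- `f` has no pole at `b`. -/
def RegAt {F : Type*} [Field F] (b : F) (f : RatFunc F) : Prop :=
  ∃ p q : Polynomial F, q.eval b ≠ 0 ∧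
    f * algebraMap (Polynomial F) (RatFunc F) q = algebraMap (Polynomial F) (RatFunc F) p

theorem RegAt.sub {F : Type*} [Field F] {b : F} {f g : RatFunc F}
    (hf : RegAt b f) (hg : RegAt b g) : RegAt b (f - g) := by
  obtain ⟨p, q, hq, h⟩ := hf
  obtain ⟨p', q', hq', h'⟩ := hg
  refine ⟨p * q' - p' * q, q * q', by simp [hq, hq'], ?_⟩
  simp only [map_mul, map_sub, ← h, ← h']
  ring

theorem RegAt.zero {F : Type*} [Field F] {b : F} : RegAt b (0 : RatFunc F) :=
  ⟨0, 1, by simp, by simp⟩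

theorem RegAt.sum {F : Type*} [Field F] {b : F} {ι : Type*} (s : Finset ι) (f : ι → RatFunc F)
    (hf : ∀ i ∈ s, RegAt b (f i)) : RegAt b (∑ i ∈ s, f i) := by
  refine Finset.sum_induction f (RegAt b) (fun x y hx hy => ?_) RegAt.zero hf
  have := hx.sub (RegAt.zero.sub hy)
  simpa using this

theorem XC_eq {F : Type*} [Field F] (s : F) : (RatFunc.X : RatFunc F) + RatFunc.C s =
    algebraMap (Polynomial F) (RatFunc F) (Polynomial.X + Polynomial.C s) := by
  simp

theorem XC_ne {F : Type*} [Field F] (s : F) : (RatFunc.X : RatFunc F) + RatFunc.C s ≠ 0 := by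
  rw [XC_eq]
  exact RatFunc.algebraMap_ne_zero (Polynomial.X_add_C_ne_zero s)

theorem RegAt.inv {F : Type*} [Field F] {a s : F} (c : F) (h : s ≠ a) :
    RegAt (-a) (RatFunc.C c * ((RatFunc.X : RatFunc F) + RatFunc.C s)⁻¹) := by
  refine ⟨Polynomial.C c, Polynomial.X + Polynomial.C s, ?_, ?_⟩
  · simp only [Polynomial.eval_add, Polynomial.eval_X, Polynomial.eval_C]
    intro h0
    exact h (by linear_combination h0)
  · rw [← XC_eq, mul_assoc, inv_mul_cancel₀ (XC_ne s)]
    simp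

/-- Soundness direction of the logarithmic-derivative lookup identity:
over a field whose characteristic is zero or greater than `n`, if
`∑ j, 1/(X + z j) = ∑ i, μ'_i / (X + t i)` holds in `F(X)` for some field
elements `μ'_i`, then every looked-up value `z j` lies in the table `t`. -/
theorem logderiv_lookup_sound (F : Type*) [Field F] (n d : ℕ)
    (z : Fin n → F) (t : Fin d → F)
    (hchar : ringChar F = 0 ∨ n < ringChar F)
    (μ' : Fin d → F)
    (h : ∑ j, ((RatFunc.X : RatFunc F) + RatFunc.C (z j))⁻¹
        = ∑ i, RatFunc.C (μ' i) * ((RatFunc.X : RatFunc F) + RatFunc.C (t i))⁻¹) :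
    ∀ j, ∃ i, z j = t i := by
  classical
  intro j
  by_contra! hne
  set a := z j with ha
  have h1 : RegAt (-a) (∑ i, RatFunc.C (μ' i) * ((RatFunc.X : RatFunc F) + RatFunc.C (t i))⁻¹) :=
    RegAt.sum _ _ fun i _ => RegAt.inv _ (hne i).symm
  have h2 : RegAt (-a) (∑ k ∈ Finset.univ.filter (fun k => ¬ z k = a),
      ((RatFunc.X : RatFunc F) + RatFunc.C (z k))⁻¹) :=
    RegAt.sum _ _ fun k hk => by
      simpa using RegAt.inv 1 (Finset.mem_filter.1 hk).2
  have h3 := h1.sub h2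
  rw [← h, ← Finset.sum_filter_add_sum_filter_not Finset.univ (fun k => z k = a),
    add_sub_cancel_right] at h3
  rw [Finset.sum_congr rfl (g := fun _ => ((RatFunc.X : RatFunc F) + RatFunc.C a)⁻¹)
    (fun k hk => by rw [(Finset.mem_filter.1 hk).2]), Finset.sum_const, nsmul_eq_mul] at h3
  set m := (Finset.univ.filter (fun k => z k = a)).card with hm
  have hmpos : 0 < m := Finset.card_pos.2 ⟨j, by simp [ha]⟩
  have hmn : m ≤ n := by
    simpa using Finset.card_le_univ (Finset.univ.filter (fun k => z k = a))
  obtain ⟨p, q, hq, hpq⟩ := h3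
  have e : (m : RatFunc F) * algebraMap (Polynomial F) (RatFunc F) q =
      algebraMap (Polynomial F) (RatFunc F) p * (RatFunc.X + RatFunc.C a) := by
    rw [← hpq]
    have := XC_ne a
    field_simp
  rw [XC_eq, ← map_natCast (algebraMap (Polynomial F) (RatFunc F)), ← map_mul, ← map_mul] at e
  have e2 := congrArg (Polynomial.eval (-a)) (RatFunc.algebraMap_injective F e)
  simp [hq] at e2
  have hdvd := (ringChar.spec F m).1 e2
  rcases hchar with h0 | h0
  · rw [h0] at hdvd
    have := Nat.eq_zero_of_zero_dvd hdvd
    omega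
  · have := Nat.le_of_dvd hmpos hdvd
    omega
end

section
/- Let F be a field, z : Fin n → F, t : Fin d → F, and μ' : Fin d → F. Suppose that, as elements of the field of rational functions F(X), we have ∑_{j ∈ Fin n} (X + z_j)⁻¹ ≠ ∑_{i ∈ Fin d} μ'_i · (X + t_i)⁻¹. Then the set of points α ∈ F such that α + z_j ≠ 0 for all j, α + t_i ≠ 0 for all i, and ∑_{j ∈ Fin n} (α + z_j)⁻¹ = ∑_{i ∈ Fin d} μ'_i · (α + t_i)⁻¹, is finite and has cardinality at most n + d. In particular, for a finite field F, checking the identity at a uniformly random point of F has soundness error at most (n+d)/|F|. -/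
open Polynomial in
/-- The numerator obtained by clearing denominators in `∑ i, c i / (X + a i)`. -/
noncomputable def lookupNumerator {F ι : Type*} [Field F] [Fintype ι] [DecidableEq ι]
    (c a : ι → F) : F[X] :=
  ∑ i, C (c i) * ∏ j ∈ Finset.univ.erase i, (X + C (a j))

open Polynomial in
theorem lookupNumerator_map {F ι K : Type*} [Field F] [Fintype ι] [DecidableEq ι] [Field K]
    (c a : ι → F) (φ : F[X] →+* K) (hne : ∀ i, φ (X + C (a i)) ≠ 0) :
    φ (lookupNumerator c a) =
      (∏ i, φ (X + C (a i))) * ∑ i, φ (C (c i)) * (φ (X + C (a i)))⁻¹ := by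
  unfold lookupNumerator
  rw [map_sum, Finset.mul_sum]
  refine Finset.sum_congr rfl fun i _ => ?_
  rw [map_mul, map_prod, ← Finset.mul_prod_erase Finset.univ _ (Finset.mem_univ i)]
  have := hne i
  field_simp

open Polynomial in
theorem lookupNumerator_natDegree {F ι : Type*} [Field F] [Fintype ι] [DecidableEq ι]
    (c a : ι → F) : (lookupNumerator c a).natDegree ≤ Fintype.card ι := by
  unfold lookupNumerator
  refine natDegree_sum_le_of_forall_le _ _ fun i _ => ?_
  refine (natDegree_C_mul_le _ _).trans ((natDegree_prod_le _ _).trans ?_)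
  simp only [natDegree_X_add_C]
  simp

/-- Schwartz–Zippel soundness of the logarithmic-derivative lookup check:
if the rational-function identity `∑ j, 1/(X + z j) = ∑ i, μ'_i/(X + t i)`
fails in `F(X)`, then the set of points `α ∈ F` avoiding all poles at which
the corresponding scalar identity nevertheless holds is finite, of
cardinality at most `n + d`. -/
theorem logderiv_lookup_schwartz_zippel (F : Type*) [Field F] (n d : ℕ)
    (z : Fin n → F) (t : Fin d → F) (μ' : Fin d → F)
    (h : ∑ j, ((RatFunc.X : RatFunc F) + RatFunc.C (z j))⁻¹
        ≠ ∑ i, RatFunc.C (μ' i) * ((RatFunc.X : RatFunc F) + RatFunc.C (t i))⁻¹) :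
    {α : F | (∀ j, α + z j ≠ 0) ∧ (∀ i, α + t i ≠ 0) ∧
        ∑ j, (α + z j)⁻¹ = ∑ i, μ' i * (α + t i)⁻¹}.Finite ∧
    {α : F | (∀ j, α + z j ≠ 0) ∧ (∀ i, α + t i ≠ 0) ∧
        ∑ j, (α + z j)⁻¹ = ∑ i, μ' i * (α + t i)⁻¹}.ncard ≤ n + d := by
  classical
  set S := {α : F | (∀ j, α + z j ≠ 0) ∧ (∀ i, α + t i ≠ 0) ∧
        ∑ j, (α + z j)⁻¹ = ∑ i, μ' i * (α + t i)⁻¹} with hS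
  let c : Fin n ⊕ Fin d → F := Sum.elim (fun _ => 1) (fun i => - μ' i)
  let a : Fin n ⊕ Fin d → F := Sum.elim z t
  have hP : lookupNumerator c a ≠ 0 := by
    intro h0
    have hne : ∀ i, algebraMap (Polynomial F) (RatFunc F)
        (Polynomial.X + Polynomial.C (a i)) ≠ 0 := fun i =>
      RatFunc.algebraMap_ne_zero (Polynomial.X_add_C_ne_zero _)
    have key := lookupNumerator_map c a (algebraMap (Polynomial F) (RatFunc F)) hne
    rw [h0, map_zero, eq_comm, mul_eq_zero] at key
    rcases key with key | key
    · exact Finset.prod_ne_zero_iff.mpr (fun i _ => hne i) key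
    · apply h
      simpa [c, a, Fintype.sum_sum_type, RatFunc.algebraMap_X, RatFunc.algebraMap_C,
        add_neg_eq_zero] using key
  have hsub : S ⊆ ↑(lookupNumerator c a).roots.toFinset := by
    rintro α ⟨h1, h2, h3⟩
    have hne : ∀ i, Polynomial.evalRingHom α (Polynomial.X + Polynomial.C (a i)) ≠ 0 := by
      rintro (i | i)
      · simpa [a] using h1 i
      · simpa [a] using h2 i
    have key := lookupNumerator_map c a (Polynomial.evalRingHom α) hne
    have hz : Polynomial.eval α (lookupNumerator c a) = 0 := by
      rw [Polynomial.coe_evalRingHom] at key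
      rw [key]
      simp [c, a, Fintype.sum_sum_type, h3]
    simp [hP, hz]
  refine ⟨(Finset.finite_toSet _).subset hsub, ?_⟩
  calc S.ncard ≤ (lookupNumerator c a).roots.toFinset.card := by
        rw [← Set.ncard_coe_finset]
        exact Set.ncard_le_ncard hsub (Finset.finite_toSet _)
    _ ≤ (lookupNumerator c a).natDegree :=
        (Multiset.toFinset_card_le _).trans (Polynomial.card_roots' _)
    _ ≤ n + d := by simpa using lookupNumerator_natDegree c a
end

section
/- Fix real constants L > 0 and b > 0 and let c : ℝ → ℝ be given by c(w) = 2^(w+1) + (L·b)/w. If ŵ > 0 satisfies 2^ŵ · ŵ² = (L·b)/(2 · log 2), then ŵ is a global minimizer of c on (0, ∞): c(ŵ) ≤ c(w) for every w > 0. -/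
/-- Any positive solution `w₀` of `2^w₀ · w₀² = L·b/(2·log 2)` is a global
minimizer of the UltraGroth prover-cost function `c(w) = 2^(w+1) + L·b/w`
on `(0, ∞)`. -/
theorem ultragroth_cost_global_min (L b : ℝ) (hL : 0 < L) (hb : 0 < b)
    (c : ℝ → ℝ) (hc : ∀ w : ℝ, c w = (2 : ℝ) ^ (w + 1) + L * b / w)
    (w₀ : ℝ) (hw₀ : 0 < w₀)
    (hopt : (2 : ℝ) ^ w₀ * w₀ ^ 2 = L * b / (2 * Real.log 2)) :
    ∀ w : ℝ, 0 < w → c w₀ ≤ c w := by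
  intro w hw
  have hl : 0 < Real.log 2 := Real.log_pos (by norm_num)
  have hA : 0 < (2 : ℝ) ^ w₀ := by positivity
  have hLb : L * b = 2 * Real.log 2 * (2 : ℝ) ^ w₀ * w₀ ^ 2 := by
    rw [eq_div_iff (by positivity)] at hopt
    linarith
  have h1 : (2 : ℝ) ^ w = (2 : ℝ) ^ w₀ * (2 : ℝ) ^ (w - w₀) := by
    rw [← Real.rpow_add (by norm_num)]
    congr 1
    ring
  have h2 : 1 + Real.log 2 * (w - w₀) ≤ (2 : ℝ) ^ (w - w₀) := by
    rw [Real.rpow_def_of_pos (by norm_num)]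
    linarith [Real.add_one_le_exp (Real.log 2 * (w - w₀))]
  have h3 : 2 * w₀ - w ≤ w₀ ^ 2 / w := by
    rw [le_div_iff₀ hw]
    nlinarith [sq_nonneg (w - w₀)]
  have h4 : L * b / w = 2 * Real.log 2 * (2 : ℝ) ^ w₀ * (w₀ ^ 2 / w) := by
    rw [hLb]
    ring
  have h5 : L * b / w₀ = 2 * Real.log 2 * (2 : ℝ) ^ w₀ * w₀ := by
    rw [hLb]
    field_simp
  have h6 := mul_le_mul_of_nonneg_left h2 hA.le
  have h7 := mul_le_mul_of_nonneg_left h3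
    (show 0 ≤ 2 * Real.log 2 * (2 : ℝ) ^ w₀ by positivity)
  rw [hc, hc, h4, h5, Real.rpow_add (by norm_num), Real.rpow_add (by norm_num), Real.rpow_one, h1]
  nlinarith [h6, h7]
end

section
/- There exists a constant C > 0 such that for every real N ≥ 4 and every ŵ > 0 satisfying 2^ŵ · ŵ² = N/(2 · log 2), one has 2^(ŵ+1) + N/ŵ ≤ C · N / log N. In other words, the minimum over w > 0 of the prover cost c(w) = 2^(w+1) + N/w is O(N / log N). -/
/-- The minimum of the UltraGroth prover cost is `O(N / log N)`: there is a
constant `C > 0` such that for all `N ≥ 4`, any positive `w₀` with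
`2^w₀ · w₀² = N/(2·log 2)` satisfies `2^(w₀+1) + N/w₀ ≤ C·N/log N`. -/
theorem ultragroth_cost_min_bigO :
    ∃ C : ℝ, 0 < C ∧ ∀ N : ℝ, 4 ≤ N → ∀ w₀ : ℝ, 0 < w₀ →
      (2 : ℝ) ^ w₀ * w₀ ^ 2 = N / (2 * Real.log 2) →
      (2 : ℝ) ^ (w₀ + 1) + N / w₀ ≤ C * N / Real.log N := by
  refine ⟨12, by norm_num, ?_⟩
  intro N hN w hw h
  have l1 : Real.log 2 < 1 := lt_trans Real.log_two_lt_d9 (by norm_num)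
  have l2 : 1 / 2 < Real.log 2 := lt_trans (by norm_num) Real.log_two_gt_d9
  have l0 : 0 < Real.log 2 := by linarith
  have hp : 0 < (2 : ℝ) ^ w := Real.rpow_pos_of_pos (by norm_num) w
  have hq : 0 < (2 : ℝ) ^ w * w ^ 2 := by positivity
  rw [eq_div_iff (by positivity)] at h
  have hw1 : 1 ≤ w := by
    by_contra hc
    push Not at hc
    have a1 : (2 : ℝ) ^ w ≤ 2 := by
      calc (2 : ℝ) ^ w ≤ (2 : ℝ) ^ (1 : ℝ) :=
            Real.rpow_le_rpow_of_exponent_le (by norm_num) hc.le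
        _ = 2 := Real.rpow_one 2
    have a2 : w ^ 2 ≤ 1 := by nlinarith
    have a3 : (2 : ℝ) ^ w * w ^ 2 ≤ 2 * 1 := by gcongr
    nlinarith
  have hN0 : 0 < N := by linarith
  have hlogpos : 0 < Real.log N := Real.log_pos (by linarith)
  have hlog : Real.log N ≤ 4 * w := by
    have b1 : N ≤ 2 * ((2 : ℝ) ^ w * w ^ 2) := by nlinarith
    have b2 := Real.log_le_log hN0 b1
    rw [Real.log_mul (by norm_num) hq.ne', Real.log_mul hp.ne' (by positivity),
      Real.log_rpow (by norm_num), Real.log_pow] at b2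
    have b3 := Real.log_le_sub_one_of_pos hw
    push_cast at b2
    nlinarith
  have hc : (2 : ℝ) ^ (w + 1) ≤ 2 * N / w := by
    rw [Real.rpow_add (by norm_num), Real.rpow_one, le_div_iff₀ hw]
    have c1 : (2 : ℝ) ^ w * w ≤ (2 : ℝ) ^ w * w ^ 2 := by
      gcongr
      nlinarith
    nlinarith
  have hd : 3 * N / w ≤ 12 * N / Real.log N := by
    rw [div_le_div_iff₀ hw hlogpos]
    nlinarith
  have he : 2 * N / w + N / w = 3 * N / w := by ring
  linarith
end

section
/- Let F be a field, n ∈ ℕ, and let z, ℓ, r, o : Fin n → F. Let α, β, γ, δ, h, t, s₀, s₁ ∈ F with γ ≠ 0 and δ ≠ 0, and set ζ_i = β·ℓ_i + α·r_i + o_i. Let I_X ⊆ Fin n be any subset and I_W its complement. Assume the QAP equation (∑_{i} z_i ℓ_i)·(∑_{i} z_i r_i) = ∑_{i} z_i o_i + h·t. Define a = α + ∑_i z_i ℓ_i + s₀·δ, b = β + ∑_i z_i r_i + s₁·δ, c = δ⁻¹·(∑_{i ∈ I_W} z_i ζ_i + h·t) + a·s₁ + b·s₀ − s₀·s₁·δ,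 and IC = γ⁻¹·∑_{i ∈ I_X} z_i ζ_i. Then a·b = α·β + IC·γ + c·δ. (This is the field identity underlying perfect completeness of the Groth16 verification equation.) -/
/-- The field identity underlying perfect completeness of the Groth16
verification equation: all polynomials are evaluated at the toxic-waste point,
`ζ i = β·ℓ i + α·r i + o i`, and the QAP equation implies
`a·b = α·β + IC·γ + c·δ`. -/
theorem groth16_completeness_field_identity (F : Type*) [Field F] (n : ℕ)
    (z ℓ r o : Fin n → F)
    (α β γ δ h t s₀ s₁ : F) (hγ : γ ≠ 0) (hδ : δ ≠ 0)
    (ζ : Fin n → F) (hζ : ∀ i, ζ i = β * ℓ i + α * r i + o i)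
    (IX : Finset (Fin n))
    (hQAP : (∑ i, z i * ℓ i) * (∑ i, z i * r i) = ∑ i, z i * o i + h * t)
    (a b c IC : F)
    (ha : a = α + ∑ i, z i * ℓ i + s₀ * δ)
    (hb : b = β + ∑ i, z i * r i + s₁ * δ)
    (hc : c = δ⁻¹ * ((∑ i ∈ IXᶜ, z i * ζ i) + h * t) + a * s₁ + b * s₀ - s₀ * s₁ * δ)
    (hIC : IC = γ⁻¹ * ∑ i ∈ IX, z i * ζ i) :
    a * b = α * β + IC * γ + c * δ := by
  have hsum : (∑ i ∈ IX, z i * ζ i) + ∑ i ∈ IXᶜ, z i * ζ i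
      = β * (∑ i, z i * ℓ i) + α * (∑ i, z i * r i) + ∑ i, z i * o i := by
    rw [Finset.sum_add_sum_compl, Finset.mul_sum, Finset.mul_sum,
      ← Finset.sum_add_distrib, ← Finset.sum_add_distrib]
    refine Finset.sum_congr rfl fun i _ => ?_
    rw [hζ i]
    ring
  have h1 : IC * γ = ∑ i ∈ IX, z i * ζ i := by
    rw [hIC]
    field_simp
  have h2 : c * δ = (∑ i ∈ IXᶜ, z i * ζ i) + h * t
      + (a * s₁ + b * s₀ - s₀ * s₁ * δ) * δ := by
    rw [hc]
    field_simp
    ring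
  rw [h1, h2, ha, hb]
  linear_combination hQAP - hsum
end

section
/- Let F be a field, n ∈ ℕ, d ∈ ℕ, and let z, ℓ, r, o : Fin n → F. Let α, β, γ, h, t, s₀, s₁ ∈ F with γ ≠ 0, let δ : Fin (d+1) → F with every δ_i ≠ 0, and let ρ : Fin d → F be round randomizers. Set ζ_i = β·ℓ_i + α·r_i + o_i. Let I_X ⊆ Fin n with complement I_W, and let I_W⁰, …, I_W^d be pairwise disjoint subsets of Fin n whose union is I_W. Assume the QAP equation (∑_i z_i ℓ_i)·(∑_i z_i r_i) = ∑_i z_i o_i + h·t. Define a = α + ∑_i z_i ℓ_i + s₀·δ_d, b = β + ∑_i z_i r_i + s₁·δ_d; for each i < d define c_i = δ_i⁻¹·∑_{j ∈ I_W^i} z_j ζ_j + ρ_i·δ_d; define c_d = δ_d⁻¹·(∑_{j ∈ I_W^d} z_j ζ_j + h·t) + a·s₁ + b·s₀ − ∑_{i < d} ρ_i·δ_i − s₀·s₁·δ_d; and define IC = γ⁻¹·∑_{i ∈ I_X} z_i ζ_i. Then a·b = α·β + IC·γ + ∑_{i = 0}^{d} δ_i·c_i. (This is the field identity underlying perfect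 completeness of the UltraGroth verification equation.) -/
/-- The field identity underlying perfect completeness of the UltraGroth
verification equation: the private witness indices are split into `d+1`
pairwise-disjoint rounds `IW 0, …, IW d` covering the complement of the public
indices `IX`, each round `i < d` is committed with its own trapdoor `δ i` and
randomizer `ρ i`, and the QAP equation implies
`a·b = α·β + IC·γ + ∑ i, δ i · c i`. -/
theorem ultragroth_completeness_field_identity (F : Type*) [Field F] (n d : ℕ)
    (z ℓ r o : Fin n → F)
    (α β γ h t s₀ s₁ : F) (hγ : γ ≠ 0)
    (δ : Fin (d + 1) → F) (hδ : ∀ i, δ i ≠ 0)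
    (ρ : Fin d → F)
    (ζ : Fin n → F) (hζ : ∀ i, ζ i = β * ℓ i + α * r i + o i)
    (IX : Finset (Fin n)) (IW : Fin (d + 1) → Finset (Fin n))
    (hdisj : ∀ i j, i ≠ j → Disjoint (IW i) (IW j))
    (hunion : Finset.univ.biUnion IW = IXᶜ)
    (hQAP : (∑ i, z i * ℓ i) * (∑ i, z i * r i) = ∑ i, z i * o i + h * t)
    (a b : F) (c : Fin (d + 1) → F) (IC : F)
    (ha : a = α + ∑ i, z i * ℓ i + s₀ * δ (Fin.last d))
    (hb : b = β + ∑ i, z i * r i + s₁ * δ (Fin.last d))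
    (hci : ∀ i : Fin d, c i.castSucc =
        (δ i.castSucc)⁻¹ * (∑ j ∈ IW i.castSucc, z j * ζ j) + ρ i * δ (Fin.last d))
    (hcd : c (Fin.last d) =
        (δ (Fin.last d))⁻¹ * ((∑ j ∈ IW (Fin.last d), z j * ζ j) + h * t)
          + a * s₁ + b * s₀ - (∑ i : Fin d, ρ i * δ i.castSucc)
          - s₀ * s₁ * δ (Fin.last d))
    (hIC : IC = γ⁻¹ * ∑ i ∈ IX, z i * ζ i) :
    a * b = α * β + IC * γ + ∑ i : Fin (d + 1), δ i * c i := by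
  have h1 : ∑ i, ∑ j ∈ IW i, z j * ζ j = ∑ j ∈ IXᶜ, z j * ζ j := by
    rw [← hunion, Finset.sum_biUnion]
    intro i _ j _ hij
    exact hdisj i j hij
  have h2 : ∑ j ∈ IX, z j * ζ j + ∑ j ∈ IXᶜ, z j * ζ j = ∑ j, z j * ζ j :=
    Finset.sum_add_sum_compl IX _
  have h3 : ∑ j, z j * ζ j
      = β * (∑ i, z i * ℓ i) + α * (∑ i, z i * r i) + ∑ i, z i * o i := by
    rw [Finset.mul_sum, Finset.mul_sum, ← Finset.sum_add_distrib, ← Finset.sum_add_distrib]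
    refine Finset.sum_congr rfl fun i _ => ?_
    rw [hζ]
    ring
  have h4 : ∑ i : Fin d, δ i.castSucc * c i.castSucc
      = ∑ i : Fin d, ∑ j ∈ IW i.castSucc, z j * ζ j
        + (∑ i : Fin d, ρ i * δ i.castSucc) * δ (Fin.last d) := by
    rw [Finset.sum_mul, ← Finset.sum_add_distrib]
    refine Finset.sum_congr rfl fun i _ => ?_
    rw [hci, mul_add, mul_inv_cancel_left₀ (hδ _)]
    ring
  have h5 : δ (Fin.last d) * c (Fin.last d)
      = (∑ j ∈ IW (Fin.last d), z j * ζ j) + h * t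
        + δ (Fin.last d) * (a * s₁ + b * s₀ - (∑ i : Fin d, ρ i * δ i.castSucc)
          - s₀ * s₁ * δ (Fin.last d)) := by
    have := mul_inv_cancel_left₀ (hδ (Fin.last d))
      ((∑ j ∈ IW (Fin.last d), z j * ζ j) + h * t)
    rw [hcd]
    linear_combination this
  have h6 : IC * γ = ∑ i ∈ IX, z i * ζ i := by
    rw [hIC, mul_comm, mul_inv_cancel_left₀ hγ]
  rw [Fin.sum_univ_castSucc] at h1 ⊢
  rw [h4, h5, h6, ha, hb]
  linear_combination hQAP - h1 - h2 - h3
end
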